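/- arXiv:1601.03870 — 2 statements merged into one kernel-verified Lean document; each statement's English description precedes it below -/
import Mathlib

section
/- There is a constant C such that for every real ν ≥ 1 and every real r with r ≥ 2ν, one has |J_ν(r)| ≤ C · r^{−1/2}. -/
open Real

/-- The Bessel function of the first kind of real order `ν`, defined for `x ≥ 0` by the
convergent power series `J_ν(x) = ∑_{m=0}^∞ (-1)^m / (m! Γ(m+ν+1)) (x/2)^{2m+ν}`
(with real exponents interpreted via `Real.rpow`, so that `J_ν(0) = 0` for `ν > 0` and
`J_0(0) = 1`). -/
noncomputable def besselJ (ν x : ℝ) : ℝ :=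
  ∑' m : ℕ, ((-1 : ℝ) ^ m / (m.factorial * Real.Gamma (m + ν + 1))) * (x / 2) ^ (2 * (m : ℝ) + ν)

/-- Entire part of the Bessel function: `J_ν(x) = (x/2)^ν G_ν(x²/4)`. -/
noncomputable def besG (ν y : ℝ) : ℝ :=
  ∑' m : ℕ, (-y) ^ m / (m.factorial * Real.Gamma (m + ν + 1))

lemma exists_gamma_lower : ∃ c : ℝ, 0 < c ∧ ∀ x : ℝ, 1 / 2 ≤ x → c ≤ Real.Gamma x := by
  have hc : ContinuousOn Real.Gamma (Set.Icc (1 / 2) 2) := by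
    intro x hx
    refine (Real.differentiableAt_Gamma fun m => ?_).continuousAt.continuousWithinAt
    have := hx.1
    have h2 : (0 : ℝ) ≤ m := Nat.cast_nonneg m
    intro h
    linarith
  obtain ⟨x0, hx0, hmin⟩ := isCompact_Icc.exists_isMinOn
    (Set.nonempty_Icc.2 (by norm_num : (1 / 2 : ℝ) ≤ 2)) hc
  have hle : ∀ x ∈ Set.Icc (1 / 2 : ℝ) 2, Real.Gamma x0 ≤ Real.Gamma x := fun x hx => hmin hx
  refine ⟨Real.Gamma x0, Real.Gamma_pos_of_pos (by linarith [hx0.1]), fun x hx => ?_⟩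
  rcases le_total x 2 with h | h
  · exact hle x ⟨hx, h⟩
  · exact (hle 2 ⟨by norm_num, le_rfl⟩).trans
      (Real.Gamma_strictMonoOn_Ici.monotoneOn Set.self_mem_Ici h h)

lemma besG_term_bound {c : ℝ} (hc : 0 < c) (hg : ∀ x : ℝ, 1 / 2 ≤ x → c ≤ Real.Gamma x)
    {ν : ℝ} (hν : -(1 / 2) ≤ ν) (y : ℝ) (m : ℕ) :
    ‖(-y) ^ m / (m.factorial * Real.Gamma (m + ν + 1))‖ ≤ c⁻¹ * (|y| ^ m / m.factorial) := by
  have h2 : (0 : ℝ) ≤ m := Nat.cast_nonneg m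
  have h3 := hg (m + ν + 1) (by linarith)
  have h4 : (0 : ℝ) < m.factorial := by positivity
  have h5 : 0 < Real.Gamma (m + ν + 1) := hc.trans_le h3
  rw [norm_div, norm_pow, norm_neg, Real.norm_eq_abs, Real.norm_eq_abs,
    abs_of_pos (mul_pos h4 h5)]
  have : c⁻¹ * (|y| ^ m / m.factorial) = |y| ^ m / (m.factorial * c) := by
    field_simp
  rw [this]
  gcongr

lemma besG_summable {ν : ℝ} (hν : -(1 / 2) ≤ ν) (y : ℝ) :
    Summable fun m : ℕ => (-y) ^ m / (m.factorial * Real.Gamma (m + ν + 1)) := by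
  obtain ⟨c, hc, hg⟩ := exists_gamma_lower
  exact Summable.of_norm_bounded ((Real.summable_pow_div_factorial |y|).mul_left c⁻¹)
    (besG_term_bound hc hg hν y)

lemma besG_rec {ν : ℝ} (hν : -(1 / 2) ≤ ν) (y : ℝ) :
    besG ν y + y * besG (ν + 2) y = (ν + 1) * besG (ν + 1) y := by
  have s0 := besG_summable hν y
  have s1 := besG_summable (ν := ν + 1) (by linarith) y
  have key : besG ν y - (ν + 1) * besG (ν + 1) y = -y * besG (ν + 2) y := by
    unfold besG
    rw [← tsum_mul_left, ← tsum_mul_left, ← s0.tsum_sub (s1.mul_left _),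
      (s0.sub (s1.mul_left _)).tsum_eq_zero_add]
    have e0 : Real.Gamma (ν + 1 + 1) = (ν + 1) * Real.Gamma (ν + 1) :=
      Real.Gamma_add_one (by linarith)
    have p0 : 0 < Real.Gamma (ν + 1) := Real.Gamma_pos_of_pos (by linarith)
    have hz : ν + 1 ≠ 0 := by linarith
    have z : (-y) ^ 0 / ((Nat.factorial 0 : ℝ) * Real.Gamma ((0 : ℕ) + ν + 1)) -
        (ν + 1) * ((-y) ^ 0 / ((Nat.factorial 0 : ℝ) * Real.Gamma ((0 : ℕ) + (ν + 1) + 1))) = 0 := by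
      simp only [Nat.cast_zero, zero_add, pow_zero, Nat.factorial_zero, Nat.cast_one, one_mul]
      rw [e0]
      field_simp
      ring
    rw [z, zero_add]
    congr 1
    ext m
    have h2 : (0 : ℝ) ≤ m := Nat.cast_nonneg m
    have a1 : ((m + 1 : ℕ) : ℝ) + ν + 1 = m + ν + 2 := by push_cast; ring
    have a2 : ((m + 1 : ℕ) : ℝ) + (ν + 1) + 1 = (m + ν + 2) + 1 := by push_cast; ring
    have a3 : (m : ℝ) + (ν + 2) + 1 = (m + ν + 2) + 1 := by ring
    have p1 : 0 < Real.Gamma (m + ν + 2) := Real.Gamma_pos_of_pos (by linarith)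
    have hz : (m : ℝ) + ν + 2 ≠ 0 := by linarith
    rw [a1, a2, a3, Real.Gamma_add_one hz, Nat.factorial_succ]
    push_cast
    have p2 : (m.factorial : ℝ) ≠ 0 := by positivity
    have p3 : (m : ℝ) + 1 ≠ 0 := by positivity
    field_simp
    ring
  linarith

lemma besG_hasDerivAt {ν : ℝ} (hν : -(1 / 2) ≤ ν) (y : ℝ) :
    HasDerivAt (besG ν) (-besG (ν + 1) y) y := by
  obtain ⟨c, hc, hg⟩ := exists_gamma_lower
  set R := |y| + 1
  have hR : 0 < R := by positivity
  let g : ℕ → ℝ → ℝ := fun m z => (-z) ^ m / (m.factorial * Real.Gamma (m + ν + 1))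
  let g' : ℕ → ℝ → ℝ := fun m z =>
    (m * (-z) ^ (m - 1) * (-1)) / (m.factorial * Real.Gamma (m + ν + 1))
  have hsucc : ∀ m z, g' (m + 1) z =
      -((-z) ^ m / (m.factorial * Real.Gamma (m + (ν + 1) + 1))) := by
    intro m z
    have h2 : (0 : ℝ) ≤ m := Nat.cast_nonneg m
    have a1 : ((m + 1 : ℕ) : ℝ) + ν + 1 = m + (ν + 1) + 1 := by push_cast; ring
    have p1 : 0 < Real.Gamma (m + (ν + 1) + 1) := Real.Gamma_pos_of_pos (by linarith)
    have p2 : (m.factorial : ℝ) ≠ 0 := by positivity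
    have p3 : (m : ℝ) + 1 ≠ 0 := by positivity
    simp only [g', a1, Nat.factorial_succ, Nat.add_sub_cancel]
    push_cast
    field_simp
  let u : ℕ → ℝ := fun m => match m with
    | 0 => 0
    | k + 1 => c⁻¹ * (R ^ k / k.factorial)
  have hu : Summable u := by
    rw [← summable_nat_add_iff 1]
    exact (Real.summable_pow_div_factorial R).mul_left c⁻¹
  have hd : HasDerivAt (fun z => ∑' m, g m z) (∑' m, g' m y) y := by
    refine hasDerivAt_tsum_of_isPreconnected (t := Set.Ioo (-R) R) (u := u) (y₀ := 0) hu isOpen_Ioo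
      isPreconnected_Ioo ?_ ?_ ⟨by linarith, hR⟩ (besG_summable hν 0) ?_
    · intro m z _
      have := (((hasDerivAt_id z).neg).pow m).div_const (m.factorial * Real.Gamma (m + ν + 1))
      simpa [g, g'] using this
    · intro m z hz
      cases m with
      | zero => simp [g', u]
      | succ k =>
        rw [hsucc, norm_neg]
        refine (besG_term_bound hc hg (by linarith) z k).trans ?_
        have : |z| ≤ R := (abs_lt.2 hz).le
        simp only [u]
        gcongr
    · have : |y| < R := by simp [R]
      exact abs_lt.1 this
  have hs : ∑' m, g' m y = -besG (ν + 1) y := by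
    have s' : Summable fun m => g' m y := by
      rw [← summable_nat_add_iff 1]
      simp only [hsucc]
      exact (besG_summable (ν := ν + 1) (by linarith) y).neg
    rw [s'.tsum_eq_zero_add]
    simp only [hsucc, tsum_neg]
    simp [g', besG]
  rw [hs] at hd
  exact hd

lemma besselJ_eq (ν : ℝ) {x : ℝ} (hx : 0 < x) :
    besselJ ν x = (x / 2) ^ ν * besG ν ((x / 2) ^ 2) := by
  unfold besselJ besG
  rw [← tsum_mul_left]
  congr 1
  ext m
  have : (x / 2) ^ (2 * (m : ℝ) + ν) = (x / 2) ^ ν * ((x / 2) ^ 2) ^ m := by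
    rw [Real.rpow_add (by positivity), mul_comm, ← pow_mul]
    congr 1
    rw [← Real.rpow_natCast]
    push_cast
    rfl
  rw [this, neg_pow ((x / 2) ^ 2)]
  ring

lemma besselJ_rec {ν : ℝ} (hν : -(1 / 2) ≤ ν) {x : ℝ} (hx : 0 < x) :
    besselJ (ν + 2) x = 2 * (ν + 1) / x * besselJ (ν + 1) x - besselJ ν x := by
  have h := besG_rec hν ((x / 2) ^ 2)
  have hx2 : 0 < x / 2 := by positivity
  rw [besselJ_eq _ hx, besselJ_eq _ hx, besselJ_eq _ hx, Real.rpow_add hx2, Real.rpow_add hx2,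
    Real.rpow_one, Real.rpow_two]
  have : 2 * (ν + 1) / x * ((x / 2) ^ ν * (x / 2) * besG (ν + 1) ((x / 2) ^ 2)) =
      (x / 2) ^ ν * ((ν + 1) * besG (ν + 1) ((x / 2) ^ 2)) := by
    field_simp
  rw [this, ← h]
  ring

lemma besselJ_hasDerivAt {ν : ℝ} (hν : -(1 / 2) ≤ ν) {x : ℝ} (hx : 0 < x) :
    HasDerivAt (besselJ ν) (ν / x * besselJ ν x - besselJ (ν + 1) x) x := by
  have hx2 : 0 < x / 2 := by positivity
  have h1 : HasDerivAt (fun z : ℝ => z / 2) (1 / 2) x := (hasDerivAt_id x).div_const 2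
  have h2 : HasDerivAt (fun z : ℝ => (z / 2) ^ ν) (1 / 2 * ν * (x / 2) ^ (ν - 1)) x :=
    h1.rpow_const (Or.inl hx2.ne')
  have h3 : HasDerivAt (fun z : ℝ => (z / 2) ^ 2) (x / 2) x := by
    refine (h1.pow 2).congr_deriv ?_
    norm_num
    ring
  have h4 : HasDerivAt (fun z : ℝ => besG ν ((z / 2) ^ 2))
      (-besG (ν + 1) ((x / 2) ^ 2) * (x / 2)) x := 
    HasDerivAt.comp (h₂ := besG ν) (h := fun z : ℝ => (z / 2) ^ 2) x
      (besG_hasDerivAt hν ((x / 2) ^ 2)) h3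
  have h5 := (h2.mul h4).congr_of_eventuallyEq
    ((eventually_gt_nhds hx).mono fun z hz => besselJ_eq ν hz)
  refine HasDerivAt.congr_deriv (f := besselJ ν) h5 ?_
  rw [besselJ_eq _ hx, besselJ_eq _ hx, Real.rpow_add hx2, Real.rpow_sub hx2, Real.rpow_one]
  field_simp
  ring

/-- Energy functional. -/
noncomputable def besW (ν r : ℝ) : ℝ :=
  r * (besselJ ν r ^ 2 + besselJ (ν + 1) r ^ 2) - (2 * ν + 1) * (besselJ ν r * besselJ (ν + 1) r)
    + (ν + 1 / 2) * besselJ ν r ^ 2 / r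

lemma besW_step {ν : ℝ} (hν : -(1 / 2) ≤ ν) {r : ℝ} (hr : 0 < r) :
    besW (ν + 1) r ≤ besW ν r := by
  have e : besW ν r - besW (ν + 1) r =
      (ν + 1 / 2) * (besselJ ν r ^ 2 + besselJ (ν + 1) r ^ 2) / r := by
    unfold besW
    have : ν + 1 + 1 = ν + 2 := by ring
    rw [this, besselJ_rec hν hr]
    field_simp
    ring
  have : 0 ≤ (ν + 1 / 2) * (besselJ ν r ^ 2 + besselJ (ν + 1) r ^ 2) / r := by
    have : 0 ≤ ν + 1 / 2 := by linarith
    positivity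
  linarith

lemma besW_hasDerivAt {ν : ℝ} (hν : -(1 / 2) ≤ ν) {r : ℝ} (hr : 0 < r) :
    HasDerivAt (besW ν) (2 * (ν ^ 2 - 1 / 4) * besselJ ν r ^ 2 / r ^ 2) r := by
  have hA := besselJ_hasDerivAt hν hr
  have hB := besselJ_hasDerivAt (ν := ν + 1) (by linarith) hr
  have e2 : ν + 1 + 1 = ν + 2 := by ring
  rw [e2, besselJ_rec hν hr] at hB
  have h := (((hasDerivAt_id r).mul ((hA.pow 2).add (hB.pow 2))).sub
    ((hA.mul hB).const_mul (2 * ν + 1))).add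
    (((hA.pow 2).const_mul (ν + 1 / 2)).div (hasDerivAt_id r) hr.ne')
  refine HasDerivAt.congr_deriv (f := besW ν) h ?_
  simp
  field_simp
  ring

lemma besW_anti {ν : ℝ} (hν : -(1 / 2) ≤ ν) (hν' : ν ≤ 1 / 2) {r : ℝ} (hr : 2 ≤ r) :
    besW ν r ≤ besW ν 2 := by
  have hanti : AntitoneOn (besW ν) (Set.Ici 2) := by
    apply antitoneOn_of_hasDerivWithinAt_nonpos (convex_Ici 2)
      (f' := fun r => 2 * (ν ^ 2 - 1 / 4) * besselJ ν r ^ 2 / r ^ 2)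
    · intro x hx
      exact (besW_hasDerivAt hν (by linarith [Set.mem_Ici.1 hx])).continuousAt.continuousWithinAt
    · intro x hx
      rw [interior_Ici] at hx
      exact (besW_hasDerivAt hν (by linarith [Set.mem_Ioi.1 hx])).hasDerivWithinAt
    · intro x hx
      have : ν ^ 2 - 1 / 4 ≤ 0 := by nlinarith
      apply div_nonpos_of_nonpos_of_nonneg _ (by positivity)
      apply mul_nonpos_of_nonpos_of_nonneg (by linarith) (by positivity)
  exact hanti Set.self_mem_Ici hr hr

lemma exists_besW_bound : ∃ K : ℝ, 0 < K ∧ ∀ ν r : ℝ, -(1 / 2) ≤ ν → ν ≤ 1 / 2 → 2 ≤ r →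
    besW ν r ≤ K := by
  obtain ⟨c, hc, hg⟩ := exists_gamma_lower
  have hs := (Real.summable_pow_div_factorial |(1 : ℝ)|).mul_left c⁻¹
  set M : ℝ := ∑' m : ℕ, c⁻¹ * (|(1 : ℝ)| ^ m / m.factorial)
  have hJ : ∀ ν : ℝ, -(1 / 2) ≤ ν → |besselJ ν 2| ≤ M := by
    intro ν hν
    rw [besselJ_eq ν (by norm_num : (0 : ℝ) < 2)]
    have : (2 : ℝ) / 2 = 1 := by norm_num
    rw [this, Real.one_rpow, one_pow, one_mul]
    exact tsum_of_norm_bounded hs.hasSum (besG_term_bound hc hg hν 1)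
  refine ⟨7 * M ^ 2 + 1, by positivity, fun ν r h1 h2 hr => (besW_anti h1 h2 hr).trans ?_⟩
  have a := hJ ν h1
  have b := hJ (ν + 1) (by linarith)
  have a2 : besselJ ν 2 ^ 2 ≤ M ^ 2 := sq_le_sq' (abs_le.1 a).1 (abs_le.1 a).2
  have b2 : besselJ (ν + 1) 2 ^ 2 ≤ M ^ 2 := sq_le_sq' (abs_le.1 b).1 (abs_le.1 b).2
  unfold besW
  set A := besselJ ν 2
  set B := besselJ (ν + 1) 2
  have hab : -(A * B) ≤ M ^ 2 := by nlinarith [sq_nonneg (A + B)]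
  have hab' : -((2 * ν + 1) * (A * B)) ≤ 2 * M ^ 2 := by
    nlinarith [mul_le_mul_of_nonneg_left hab (by linarith : 0 ≤ 2 * ν + 1), sq_nonneg M]
  have h3 : (ν + 1 / 2) * A ^ 2 ≤ M ^ 2 := by nlinarith [sq_nonneg A]
  linarith [sq_nonneg M]

lemma besW_le_of_nat {K r : ℝ} (hr : 2 ≤ r)
    (hK : ∀ ν : ℝ, -(1 / 2) ≤ ν → ν ≤ 1 / 2 → besW ν r ≤ K) (n : ℕ) :
    ∀ ν : ℝ, -(1 / 2) ≤ ν → ν ≤ 1 / 2 + n → besW ν r ≤ K := by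
  induction n with
  | zero => simpa using hK
  | succ n ih =>
    intro ν h1 h2
    push_cast at h2
    rcases le_total ν (1 / 2) with h | h
    · exact hK ν h1 h
    · have := besW_step (ν := ν - 1) (by linarith) (by linarith : 0 < r)
      rw [sub_add_cancel] at this
      exact this.trans (ih (ν - 1) (by linarith) (by linarith))

/-- **Decay of Bessel functions in the oscillatory regime:** there is a constant `C` such
that `|J_ν(r)| ≤ C r^{-1/2}` for all `ν ≥ 1` and `r ≥ 2ν`. -/
theorem besselJ_decay_oscillatory :
    ∃ C : ℝ, 0 < C ∧ ∀ ν r : ℝ, 1 ≤ ν → 2 * ν ≤ r →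
      |besselJ ν r| ≤ C * r ^ (-(1 : ℝ) / 2) := by
  obtain ⟨K, hK, hb⟩ := exists_besW_bound
  refine ⟨√(2 * K), by positivity, fun ν r hν hr => ?_⟩
  have hr2 : 2 ≤ r := by linarith
  have hr0 : 0 < r := by linarith
  obtain ⟨n, hn⟩ := exists_nat_ge ν
  have hW := besW_le_of_nat hr2 (fun ν h1 h2 => hb ν r h1 h2 hr2) n ν (by linarith) (by linarith)
  have e : besW ν r = r * (besselJ (ν + 1) r - (2 * ν + 1) / (2 * r) * besselJ ν r) ^ 2
      + (r - (ν ^ 2 - 1 / 4) / r) * besselJ ν r ^ 2 := by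
    unfold besW
    field_simp
    ring
  have hq : r / 2 ≤ r - (ν ^ 2 - 1 / 4) / r := by
    have : (ν ^ 2 - 1 / 4) / r ≤ r / 2 := by
      rw [div_le_iff₀ hr0]
      nlinarith
    linarith
  have h1 : r / 2 * besselJ ν r ^ 2 ≤ K := by
    have h2 := mul_le_mul_of_nonneg_right hq (sq_nonneg (besselJ ν r))
    have h3 : 0 ≤ r * (besselJ (ν + 1) r - (2 * ν + 1) / (2 * r) * besselJ ν r) ^ 2 := by
      positivity
    linarith
  have hpow : r ^ (-(1 : ℝ) / 2) = (√r)⁻¹ := by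
    rw [neg_div, Real.rpow_neg hr0.le, Real.sqrt_eq_rpow]
  rw [hpow, ← div_eq_mul_inv, ← Real.sqrt_div (by positivity)]
  apply Real.abs_le_sqrt
  rw [le_div_iff₀ hr0]
  linarith
end

section
/- There is a constant C such that for every real ν ≥ 1 and every real ρ with 1 ≤ ρ ≤ (3/2) ν^{2/3}, one has |J_ν( ν − ρ ν^{1/3} )| ≤ C / ( ρ ν^{1/3} ). -/
open Real

/-- coefficients of the entire part -/
noncomputable def bcoef (ν : ℝ) (m : ℕ) : ℝ :=
  (-1 : ℝ) ^ m / (m.factorial * Real.Gamma (m + ν + 1))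

noncomputable def bphi (ν t : ℝ) : ℝ := ∑' m : ℕ, bcoef ν m * t ^ m

lemma gamma_ge_one {x : ℝ} (hx : 2 ≤ x) : 1 ≤ Real.Gamma x := by
  rw [← Real.Gamma_two]
  exact Real.Gamma_strictMonoOn_Ici.monotoneOn (by simp) (by simpa using hx) hx

lemma bcoef_abs_le {ν : ℝ} (hν : 1 ≤ ν) (m : ℕ) : |bcoef ν m| ≤ 1 / (m.factorial : ℝ) := by
  have h1 : 1 ≤ Real.Gamma (m + ν + 1) := gamma_ge_one (by
    have : (0 : ℝ) ≤ m := by positivity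
    linarith)
  have h2 : (0 : ℝ) < m.factorial := by positivity
  unfold bcoef
  rw [abs_div, abs_pow, abs_neg, abs_one, one_pow, abs_of_pos (by positivity)]
  apply one_div_le_one_div_of_le h2
  nlinarith

lemma bphi_summable {ν : ℝ} (hν : 1 ≤ ν) (t : ℝ) : Summable fun m : ℕ => bcoef ν m * t ^ m := by
  apply Summable.of_norm_bounded (Real.summable_pow_div_factorial |t|)
  intro m
  rw [Real.norm_eq_abs, abs_mul, abs_pow]
  calc _ ≤ 1 / (m.factorial : ℝ) * |t| ^ m := by gcongr; exact bcoef_abs_le hν m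
    _ = _ := by ring

lemma bcoef_succ (ν : ℝ) (m : ℕ) : ((m : ℝ) + 1) * bcoef ν (m + 1) = - bcoef (ν + 1) m := by
  unfold bcoef
  have h : ((m + 1 : ℕ) : ℝ) + ν + 1 = m + (ν + 1) + 1 := by push_cast; ring
  rw [h, Nat.factorial_succ, pow_succ]
  have h2 : (0 : ℝ) < m.factorial := by positivity
  push_cast
  field_simp

lemma bphi_hasDerivAt {ν : ℝ} (hν : 1 ≤ ν) (t : ℝ) :
    HasDerivAt (bphi ν) (- bphi (ν + 1) t) t := by
  set R := |t| + 1 with hR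
  have hR0 : 0 < R := by positivity
  have hsum : Summable fun m : ℕ => (m : ℝ) * (1 / (m.factorial : ℝ)) * R ^ (m - 1) := by
    rw [← summable_nat_add_iff 1]
    refine (Real.summable_pow_div_factorial R).congr fun m => ?_
    rw [Nat.factorial_succ]
    have h2 : (0 : ℝ) < m.factorial := by positivity
    push_cast
    field_simp
  have key := hasDerivAt_tsum_of_isPreconnected (𝕜 := ℝ) (F := ℝ)
    (g := fun (m : ℕ) y => bcoef ν m * y ^ m)
    (g' := fun (m : ℕ) y => bcoef ν m * ((m : ℝ) * y ^ (m - 1)))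
    (t := Metric.ball (0 : ℝ) R) (y₀ := 0) (y := t) hsum Metric.isOpen_ball
    (convex_ball _ _).isPreconnected ?_ ?_ (by simpa using hR0) (bphi_summable hν 0)
    (by simp [hR])
  · have e : ∑' m : ℕ, bcoef ν m * ((m : ℝ) * t ^ (m - 1)) = - bphi (ν + 1) t := by
      have hs : Summable fun m : ℕ => bcoef ν m * ((m : ℝ) * t ^ (m - 1)) := by
        apply Summable.of_norm_bounded hsum
        intro m
        rw [Real.norm_eq_abs, abs_mul, abs_mul, abs_pow, abs_of_nonneg (by positivity : (0 : ℝ) ≤ m)]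
        calc _ ≤ 1 / (m.factorial : ℝ) * ((m : ℝ) * R ^ (m - 1)) := by
              gcongr
              · exact bcoef_abs_le hν m
              · linarith
          _ = _ := by ring
      rw [hs.tsum_eq_zero_add]
      unfold bphi
      rw [← tsum_neg]
      simp only [Nat.cast_zero, zero_mul, mul_zero, zero_add, Nat.add_sub_cancel]
      refine tsum_congr fun m => ?_
      have := bcoef_succ ν m
      push_cast
      linear_combination t ^ m * this
    rw [← e]
    exact key
  · intro m y _
    exact (hasDerivAt_pow m y).const_mul _
  · intro m y hy
    have hy' : |y| ≤ R := by
      have := mem_ball_zero_iff.1 hy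
      exact this.le
    rw [Real.norm_eq_abs, abs_mul, abs_mul, abs_pow, abs_of_nonneg (by positivity : (0 : ℝ) ≤ m)]
    calc _ ≤ 1 / (m.factorial : ℝ) * ((m : ℝ) * R ^ (m - 1)) := by
          gcongr
          exact bcoef_abs_le hν m
      _ = _ := by ring

lemma bphi_rec {ν : ℝ} (hν : 1 ≤ ν) (t : ℝ) :
    t * bphi (ν + 2) t = (ν + 1) * bphi (ν + 1) t - bphi ν t := by
  have h1 := bphi_summable hν t
  have h2 := bphi_summable (by linarith : (1 : ℝ) ≤ ν + 1) t
  have h3 := bphi_summable (by linarith : (1 : ℝ) ≤ ν + 2) t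
  have hc : ∀ m : ℕ, bcoef ν m = ((m : ℝ) + ν + 1) * bcoef (ν + 1) m := by
    intro m
    unfold bcoef
    have hp : (0 : ℝ) < (m : ℝ) + ν + 1 := by positivity
    rw [show (m : ℝ) + (ν + 1) + 1 = ((m : ℝ) + ν + 1) + 1 by ring, Real.Gamma_add_one hp.ne']
    have := Real.Gamma_pos_of_pos hp
    field_simp
  have hd : Summable fun m : ℕ => (m : ℝ) * bcoef (ν + 1) m * t ^ m := by
    have := h1.sub (h2.mul_left (ν + 1))
    refine this.congr fun m => ?_
    rw [hc m]; ring
  have e1 : bphi ν t = ∑' m : ℕ, (m : ℝ) * bcoef (ν + 1) m * t ^ m + (ν + 1) * bphi (ν + 1) t := by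
    unfold bphi
    rw [← tsum_mul_left, ← hd.tsum_add (h2.mul_left (ν + 1))]
    refine tsum_congr fun m => ?_
    rw [hc m]; ring
  have e2 : ∑' m : ℕ, (m : ℝ) * bcoef (ν + 1) m * t ^ m = - (t * bphi (ν + 2) t) := by
    rw [hd.tsum_eq_zero_add]
    unfold bphi
    rw [← tsum_mul_left, ← tsum_neg]
    simp only [Nat.cast_zero, zero_mul, zero_add]
    refine tsum_congr fun m => ?_
    have := bcoef_succ (ν + 1) m
    rw [show ν + 1 + 1 = ν + 2 by ring] at this
    push_cast
    linear_combination t ^ (m + 1) * this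
  linarith

lemma bphi_zero (ν : ℝ) : bphi ν 0 = 1 / Real.Gamma (ν + 1) := by
  unfold bphi
  rw [tsum_eq_single 0]
  · simp [bcoef]
  · intro m hm
    simp [hm]

lemma besselJ_nonneg_arg {ν : ℝ} (hν : 1 ≤ ν) {x : ℝ} (hx : 0 ≤ x) :
    besselJ ν x = (x / 2) ^ ν * bphi ν ((x / 2) ^ 2) := by
  unfold besselJ bphi
  rw [← tsum_mul_left]
  refine tsum_congr fun m => ?_
  have hm : (0 : ℝ) ≤ m := by positivity
  rw [Real.rpow_add' (by positivity) (by positivity), bcoef, ← pow_mul, ← Real.rpow_natCast (x / 2)]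
  push_cast
  ring

lemma besselJ_neg_arg {ν : ℝ} {x : ℝ} (hx : x < 0) :
    besselJ ν x = Real.cos (ν * π) * besselJ ν (-x) := by
  unfold besselJ
  rw [← tsum_mul_left]
  refine tsum_congr fun m => ?_
  rw [Real.rpow_def_of_neg (by linarith), Real.rpow_def_of_pos (by linarith), neg_div, Real.log_neg_eq_log,
    show (2 * (m : ℝ) + ν) * π = ν * π + m * (2 * π) by ring, Real.cos_add_nat_mul_two_pi]
  ring

lemma mono_aux {f f' : ℝ → ℝ} {T : ℝ} (hc : ContinuousOn f (Set.Icc 0 T))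
    (hd : ∀ t, 0 < t → t < T → HasDerivAt f (f' t) t) (h0 : ∀ t, 0 < t → t < T → 0 ≤ f' t) :
    MonotoneOn f (Set.Icc 0 T) := by
  refine monotoneOn_of_hasDerivWithinAt_nonneg (convex_Icc 0 T) (f' := f') hc ?_ ?_
  · intro t ht
    rw [interior_Icc] at ht
    exact (hd t ht.1 ht.2).hasDerivWithinAt
  · intro t ht
    rw [interior_Icc] at ht
    exact h0 t ht.1 ht.2

lemma bphi_pos {ν : ℝ} (hν : 1 ≤ ν) {t : ℝ} (ht0 : 0 ≤ t) (htT : t ≤ ν ^ 2 / 4) : 0 < bphi ν t := by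
  have da := bphi_hasDerivAt hν
  have dp : ∀ t, HasDerivAt (bphi (ν + 1)) (- bphi (ν + 2) t) t := fun t => by
    have := bphi_hasDerivAt (by linarith : (1 : ℝ) ≤ ν + 1) t
    rwa [show ν + 1 + 1 = ν + 2 by ring] at this
  have hrec := bphi_rec hν
  have hz : 0 < bphi ν 0 := by
    rw [bphi_zero]
    have := Real.Gamma_pos_of_pos (by linarith : 0 < ν + 1)
    positivity
  generalize bphi ν = a at *
  generalize bphi (ν + 1) = p at *
  generalize bphi (ν + 2) = q at *
  have hr : ∀ t : ℝ, 0 < t → t ^ ν = t ^ (ν - 1) * t := fun t h => by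
    rw [← Real.rpow_add_one h.ne']; ring_nf
  have dr : ∀ t : ℝ, HasDerivAt (fun t : ℝ => t ^ ν) (ν * t ^ (ν - 1)) t :=
    fun t => Real.hasDerivAt_rpow_const (Or.inr hν)
  have d1 : ∀ t, HasDerivAt (fun t => ν * a t - 2 * (t * p t))
      (ν * (-p t) - 2 * (1 * p t + t * (- q t))) t := fun t =>
    ((da t).const_mul ν).sub (((hasDerivAt_id t).mul (dp t)).const_mul 2)
  have dN := fun t => ((dr t).mul (da t)).mul (d1 t)
  have hN : MonotoneOn ((fun t : ℝ => t ^ ν) * a * fun t => ν * a t - 2 * (t * p t)) (Set.Icc 0 (ν ^ 2 / 4)) := by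
    refine mono_aux (fun t _ => (dN t).continuousAt.continuousWithinAt) (fun t _ _ => dN t) ?_
    intro t h0 h1
    have hpos : 0 < t ^ (ν - 1) := Real.rpow_pos_of_pos h0 _
    have : (0 : ℝ) ≤ t ^ (ν - 1) * ((ν * a t - 2 * (t * p t)) ^ 2 / 2 + (ν ^ 2 / 2 - 2 * t) * a t ^ 2) := by
      have : 0 ≤ ν ^ 2 / 2 - 2 * t := by linarith
      positivity
    refine this.trans (le_of_eq ?_)
    simp only [Pi.mul_apply]
    rw [hr t h0]
    linear_combination (-2 * t ^ (ν - 1) * t * a t) * hrec t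
  have dV := fun t => ((dr t).mul ((da t).mul (da t)))
  have hV : MonotoneOn ((fun t : ℝ => t ^ ν) * (a * a)) (Set.Icc 0 (ν ^ 2 / 4)) := by
    refine mono_aux (fun t _ => (dV t).continuousAt.continuousWithinAt) (fun t _ _ => dV t) ?_
    intro t h0 h1
    have := hN ⟨le_rfl, by positivity⟩ ⟨h0.le, h1.le⟩ h0.le
    simp only [Pi.mul_apply, Real.zero_rpow (by linarith : ν ≠ 0), zero_mul] at this
    simp only [Pi.mul_apply]
    rw [hr t h0] at this ⊢
    have h3 : 0 ≤ t * (t ^ (ν - 1) * a t * (ν * a t - 2 * (t * p t))) := by linarith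
    have h4 := nonneg_of_mul_nonneg_right h3 h0
    linarith
  have ca : Continuous a := continuous_iff_continuousAt.2 fun t => (da t).continuousAt
  by_contra hneg
  push Not at hneg
  obtain ⟨t1, ⟨h10, h11⟩, hat⟩ := intermediate_value_Icc' ht0 ca.continuousOn ⟨hneg, hz.le⟩
  have ht1 : 0 < t1 := by
    rcases h10.eq_or_lt with h | h
    · rw [← h] at hat; linarith
    · exact h
  have hzero : ∀ u ∈ Set.Ioc 0 t1, a u = 0 := by
    intro u hu
    have := hV ⟨hu.1.le, hu.2.trans (h11.trans htT)⟩ ⟨h10, h11.trans htT⟩ hu.2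
    simp only [Pi.mul_apply, hat, mul_zero] at this
    have hp := Real.rpow_pos_of_pos hu.1 ν
    have : a u * a u ≤ 0 := by
      by_contra hc
      push Not at hc
      have := mul_pos hp hc
      linarith
    nlinarith
  have hcl : (0 : ℝ) ∈ closure (Set.Ioc 0 t1) := by
    rw [closure_Ioc ht1.ne]; exact ⟨le_rfl, h10⟩
  have : Set.EqOn a (fun _ => 0) (closure (Set.Ioc 0 t1)) :=
    Set.EqOn.closure hzero ca continuous_const
  have := this hcl
  simp at this
  linarith

noncomputable def sfun (ν t : ℝ) : ℝ := √(1 - 4 * t / ν ^ 2)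

noncomputable def Lfun (ν s : ℝ) : ℝ := ν * s - ν * Real.log (1 + s) - Real.log s / 2

lemma bphi_le {ν : ℝ} (hν : 1 ≤ ν) {t : ℝ} (ht0 : 0 ≤ t) (htT : t < ν ^ 2 / 4) :
    bphi ν t ≤ 1 / Real.Gamma (ν + 1) * Real.exp (Lfun ν (sfun ν t) - Lfun ν 1) := by
  have hν0 : 0 < ν := by linarith
  have da := bphi_hasDerivAt hν
  have dp : ∀ t, HasDerivAt (bphi (ν + 1)) (- bphi (ν + 2) t) t := fun t => by
    have := bphi_hasDerivAt (by linarith : (1 : ℝ) ≤ ν + 1) t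
    rwa [show ν + 1 + 1 = ν + 2 by ring] at this
  have hrec := bphi_rec hν
  have hpos : ∀ u, 0 ≤ u → u ≤ ν ^ 2 / 4 → 0 < bphi ν u := fun u h1 h2 => bphi_pos hν h1 h2
  rw [← bphi_zero]
  generalize bphi ν = a at *
  generalize bphi (ν + 1) = p at *
  generalize bphi (ν + 2) = q at *
  have hr : ∀ t : ℝ, 0 < t → t ^ ν = t ^ (ν - 1) * t := fun t h => by
    rw [← Real.rpow_add_one h.ne']; ring_nf
  have dr : ∀ t : ℝ, HasDerivAt (fun t : ℝ => t ^ ν) (ν * t ^ (ν - 1)) t :=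
    fun t => Real.hasDerivAt_rpow_const (Or.inr hν)
  have hs1 : ∀ u < ν ^ 2 / 4, 0 < 1 - 4 * u / ν ^ 2 := fun u hu => by
    rw [sub_pos, div_lt_one (by positivity)]; linarith
  have hs : ∀ u < ν ^ 2 / 4, 0 < sfun ν u := fun u hu => Real.sqrt_pos.2 (hs1 u hu)
  have hsq : ∀ u < ν ^ 2 / 4, u = ν ^ 2 * (1 - sfun ν u ^ 2) / 4 := fun u hu => by
    unfold sfun
    rw [Real.sq_sqrt (hs1 u hu).le]
    field_simp
    ring
  have ds : ∀ u < ν ^ 2 / 4, HasDerivAt (sfun ν) (-2 / (ν ^ 2 * sfun ν u)) u := fun u hu => by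
    have h1 : HasDerivAt (fun u => 1 - 4 * u / ν ^ 2) (-(4 * 1 / ν ^ 2)) u :=
      (((hasDerivAt_id u).const_mul 4).div_const _).const_sub 1
    have h2 := h1.sqrt (hs1 u hu).ne'
    have h3 := hs u hu
    refine h2.congr_deriv ?_
    change _ / (2 * sfun ν u) = _
    field_simp
    norm_num
  have dL : ∀ u < ν ^ 2 / 4, HasDerivAt (fun u => Lfun ν (sfun ν u))
      ((ν * sfun ν u / (1 + sfun ν u) - 1 / (2 * sfun ν u)) * (-2 / (ν ^ 2 * sfun ν u))) u := fun u hu => by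
    have h3 := hs u hu
    have h1 : HasDerivAt (Lfun ν) (ν * 1 - ν * (1 / (1 + sfun ν u)) - (1 / sfun ν u) / 2) (sfun ν u) := by
      unfold Lfun
      exact (((hasDerivAt_id (sfun ν u)).const_mul ν).sub ((((hasDerivAt_id (sfun ν u)).const_add 1).log
        (by simp only [id]; positivity)).const_mul ν)).sub (((hasDerivAt_id (sfun ν u)).log h3.ne').div_const 2)
    have h2 := h1.comp u (ds u hu)
    refine h2.congr_deriv ?_
    field_simp
    ring
  set r : ℝ → ℝ := fun u => -(ν * (1 - sfun ν u) / 2) + (1 / sfun ν u ^ 2 - 1) / 4 with hrdef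
  have drr : ∀ u < ν ^ 2 / 4, HasDerivAt r
      ((ν / 2 - 1 / (2 * sfun ν u ^ 3)) * (-2 / (ν ^ 2 * sfun ν u))) u := fun u hu => by
    have h3 := hs u hu
    have h1 := ((((ds u hu).const_sub 1).const_mul ν).div_const 2).neg
    have h2 := (((((ds u hu).pow 2).fun_inv (by simp only [Pi.pow_apply]; positivity)).sub_const 1).div_const 4)
    have h4 := h1.add h2
    have h5 : r = (-fun x => ν * (1 - sfun ν x) / 2) + fun x => (((sfun ν ^ 2) x)⁻¹ - 1) / 4 := by
      funext u
      simp [hrdef]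
    rw [h5]
    refine h4.congr_deriv ?_
    simp only [Pi.pow_apply]
    field_simp
    norm_num
    try ring
  have db : ∀ u, HasDerivAt (fun u => u * p u) (1 * p u + u * (- q u)) u := fun u =>
    (hasDerivAt_id u).mul (dp u)
  have tL : ∀ u < ν ^ 2 / 4, u * ((ν * sfun ν u / (1 + sfun ν u) - 1 / (2 * sfun ν u)) *
      (-2 / (ν ^ 2 * sfun ν u))) = r u := fun u hu => by
    have h3 := hs u hu
    have h4 := hsq u hu
    simp only [hrdef]
    generalize sfun ν u = s at *
    subst h4
    field_simp
    ring
  have tr : ∀ u < ν ^ 2 / 4, 0 ≤ u → 0 ≤ ν * r u + r u ^ 2 + u +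
      u * ((ν / 2 - 1 / (2 * sfun ν u ^ 3)) * (-2 / (ν ^ 2 * sfun ν u))) := fun u hu hu0 => by
    have h3 := hs u hu
    have h4 := hsq u hu
    simp only [hrdef]
    generalize sfun ν u = s at *
    have h5 : 0 ≤ 1 - s ^ 2 := by
      rw [h4] at hu0
      have : 0 < ν ^ 2 := by positivity
      by_contra hc
      push Not at hc
      nlinarith
    have : 0 ≤ ((1 - s ^ 2) / (4 * s ^ 2)) ^ 2 + (1 - s ^ 2) / (4 * s ^ 2) / s ^ 2 := by positivity
    refine this.trans (le_of_eq ?_)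
    subst h4
    field_simp
    ring
  have dM := fun u (hu : u < ν ^ 2 / 4) =>
    ((dr u).mul ((dL u hu).exp)).mul ((db u).add ((da u).mul (drr u hu)))
  have hM : ∀ u, 0 < u → u < ν ^ 2 / 4 → 0 ≤ u * p u + a u * r u := by
    intro u hu0 hu1
    have hmono := mono_aux (T := u) (fun v hv => (dM v (hv.2.trans_lt hu1)).continuousAt.continuousWithinAt)
      (fun v _ hv => dM v (hv.trans hu1)) (by
        intro v hv0 hv1
        have hv : v < ν ^ 2 / 4 := hv1.trans hu1
        have h1 := tr v hv hv0.le
        have h2 := tL v hv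
        have hp := Real.rpow_pos_of_pos hv0 (ν - 1)
        have ha := hpos v hv0.le hv.le
        have he := Real.exp_pos (Lfun ν (sfun ν v))
        have := mul_nonneg (mul_pos (mul_pos hp he) ha).le h1
        refine this.trans (le_of_eq ?_)
        simp only [Pi.mul_apply, Pi.add_apply]
        rw [hr v hv0]
        generalize (ν / 2 - 1 / (2 * sfun ν v ^ 3)) * (-2 / (ν ^ 2 * sfun ν v)) = r' at *
        generalize (ν * sfun ν v / (1 + sfun ν v) - 1 / (2 * sfun ν v)) * (-2 / (ν ^ 2 * sfun ν v)) = L' at *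
        generalize Real.exp (Lfun ν (sfun ν v)) = E at *
        generalize v ^ (ν - 1) = w at *
        have h5 := hrec v
        rw [← h2]
        linear_combination (w * E * v) * h5)
    have h6 := hmono ⟨le_rfl, hu0.le⟩ ⟨hu0.le, le_rfl⟩ hu0.le
    simp only [Pi.mul_apply, Pi.add_apply, Real.zero_rpow hν0.ne', zero_mul] at h6
    have hp := Real.rpow_pos_of_pos hu0 ν
    have he := Real.exp_pos (Lfun ν (sfun ν u))
    exact nonneg_of_mul_nonneg_right h6 (mul_pos hp he)
  have dQ := fun u (hu : u < ν ^ 2 / 4) => ((da u).mul ((dL u hu).neg.exp)).neg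
  have hmono := mono_aux (T := t) (fun v hv => (dQ v (hv.2.trans_lt htT)).continuousAt.continuousWithinAt)
      (fun v _ hv => dQ v (hv.trans htT)) (by
        intro v hv0 hv1
        have hv : v < ν ^ 2 / 4 := hv1.trans htT
        have h2 := tL v hv
        have he := Real.exp_pos (-Lfun ν (sfun ν v))
        have h3 := hM v hv0 hv
        rw [← h2] at h3
        simp only [Pi.neg_apply]
        generalize (ν * sfun ν v / (1 + sfun ν v) - 1 / (2 * sfun ν v)) * (-2 / (ν ^ 2 * sfun ν v)) = L' at *
        generalize Real.exp (-Lfun ν (sfun ν v)) = E at *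
        have h4 : 0 ≤ v * (p v + a v * L') := by linarith
        have h5 := nonneg_of_mul_nonneg_right h4 hv0
        have := mul_nonneg he.le h5
        refine this.trans (le_of_eq ?_)
        ring)
  have h7 := hmono ⟨le_rfl, ht0⟩ ⟨ht0, le_rfl⟩ ht0
  simp only [Pi.neg_apply, Pi.mul_apply] at h7
  have hs0 : sfun ν 0 = 1 := by simp [sfun]
  rw [hs0] at h7
  have h8 : a t * Real.exp (-Lfun ν (sfun ν t)) ≤ a 0 * Real.exp (-Lfun ν 1) := by linarith
  calc a t = (a t * Real.exp (-Lfun ν (sfun ν t))) * Real.exp (Lfun ν (sfun ν t)) := by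
        rw [mul_assoc, ← Real.exp_add]; simp
    _ ≤ (a 0 * Real.exp (-Lfun ν 1)) * Real.exp (Lfun ν (sfun ν t)) := by gcongr
    _ = _ := by rw [mul_assoc, ← Real.exp_add]; ring_nf

lemma gamma_lower {ν : ℝ} (hν : 1 ≤ ν) :
    √ν * Real.exp (ν * Real.log ν - ν - 1 / 2) ≤ Real.Gamma (ν + 1) := by
  have hν0 : 0 < ν := by linarith
  rw [Real.Gamma_eq_integral (by linarith)]
  have hint := Real.GammaIntegral_convergent (by linarith : 0 < ν + 1)
  have hsub : Set.Icc ν (ν + √ν) ⊆ Set.Ioi 0 := fun x hx => hν0.trans_le hx.1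
  have h1 : ∫ x in Set.Icc ν (ν + √ν), Real.exp (-x) * x ^ (ν + 1 - 1) ≤
      ∫ x in Set.Ioi 0, Real.exp (-x) * x ^ (ν + 1 - 1) := by
    refine MeasureTheory.setIntegral_mono_set hint ?_ hsub.eventuallyLE
    filter_upwards [MeasureTheory.ae_restrict_mem measurableSet_Ioi] with x hx
    have := Real.rpow_nonneg (le_of_lt hx) (ν + 1 - 1)
    simp only [Pi.zero_apply]
    positivity
  refine le_trans ?_ h1
  have h2 : ∫ x in Set.Icc ν (ν + √ν), Real.exp (ν * Real.log ν - ν - 1 / 2) =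
      √ν * Real.exp (ν * Real.log ν - ν - 1 / 2) := by
    rw [MeasureTheory.setIntegral_const]
    simp [Real.sqrt_nonneg]
  rw [← h2]
  refine MeasureTheory.setIntegral_mono_on (by simp) (hint.mono_set hsub) measurableSet_Icc ?_
  intro x hx
  have hx0 : 0 < x := hsub hx
  rw [Real.rpow_def_of_pos hx0, ← Real.exp_add]
  apply Real.exp_le_exp.2
  obtain ⟨d, rfl⟩ : ∃ d, x = ν * (1 + d) := ⟨x / ν - 1, by field_simp; ring⟩
  have hd0 : 0 ≤ d := by
    have := hx.1
    by_contra hc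
    push Not at hc
    nlinarith
  have hd1 : ν * d ≤ √ν := by linarith [hx.2]
  have hd2 : (ν * d) ^ 2 ≤ ν := by
    calc _ ≤ √ν ^ 2 := by gcongr
      _ = ν := Real.sq_sqrt hν0.le
  have hd3 : ν * d ^ 2 ≤ 1 := by
    by_contra hc
    push Not at hc
    nlinarith
  have hlog := Real.le_log_one_add_of_nonneg hd0
  have hlog2 : d - d ^ 2 / 2 ≤ Real.log (1 + d) := by
    refine le_trans ?_ hlog
    rw [le_div_iff₀ (by positivity)]
    nlinarith [pow_nonneg hd0 3]
  rw [Real.log_mul hν0.ne' (by positivity)]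
  nlinarith [mul_le_mul_of_nonneg_left hlog2 hν0.le]

lemma log_bound {s : ℝ} (h0 : 0 ≤ s) (h1 : s < 1) :
    2 * s + 2 * s ^ 3 / 3 ≤ Real.log (1 + s) - Real.log (1 - s) := by
  have h := Real.hasSum_log_sub_log_of_abs_lt_one (x := s) (by rwa [abs_of_nonneg h0])
  have := sum_le_hasSum (Finset.range 2) (fun i _ => by positivity) h
  simp only [Finset.sum_range_succ, Finset.sum_range_zero] at this
  norm_num at this
  linarith

/-- main bound for arguments below the turning point -/
lemma besselJ_main {ν x : ℝ} (hν : 1 ≤ ν) (hx : 0 ≤ x) (hxν : x < ν) :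
    |besselJ ν x| * (ν - x) ≤ 3 * Real.exp (1 / 2) := by
  have hν0 : 0 < ν := by linarith
  rcases hx.eq_or_lt with h | hx0
  · rw [besselJ_nonneg_arg hν hx, ← h]
    simp [Real.zero_rpow hν0.ne']
    positivity
  have hlt : (x / 2) ^ 2 < ν ^ 2 / 4 := by nlinarith
  have hp := bphi_pos hν (by positivity) hlt.le
  have hle := bphi_le hν (by positivity) hlt
  have hx2 := Real.rpow_pos_of_pos (by positivity : 0 < x / 2) ν
  rw [besselJ_nonneg_arg hν hx, abs_of_pos (mul_pos hx2 hp)]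
  set s := sfun ν ((x / 2) ^ 2) with hs
  have hz : 1 - 4 * (x / 2) ^ 2 / ν ^ 2 = 1 - (x / ν) ^ 2 := by field_simp; ring
  set z := x / ν with hzdef
  have hz0 : 0 < z := by positivity
  have hz1 : z < 1 := by rw [hzdef, div_lt_one hν0]; exact hxν
  have hxz : x = ν * z := by rw [hzdef]; field_simp
  have hs2 : s ^ 2 = 1 - z ^ 2 := by
    rw [hs, sfun, hz, Real.sq_sqrt (by nlinarith)]
  have hs0 : 0 < s := by
    rw [hs, sfun, hz]
    exact Real.sqrt_pos.2 (by nlinarith)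
  have hs1 : s < 1 := by nlinarith
  have hG := gamma_lower hν
  have hsν : 0 < √ν := Real.sqrt_pos.2 hν0
  have hlog := log_bound hs0.le hs1
  have hlogz : 2 * Real.log z = Real.log (1 + s) + Real.log (1 - s) := by
    rw [← Real.log_mul (by linarith) (by linarith)]
    rw [show (1 + s) * (1 - s) = z ^ 2 by linarith]
    rw [Real.log_pow]; norm_num
  have hb : (x / 2) ^ ν * bphi ν ((x / 2) ^ 2) ≤
      Real.exp (1 / 2) / √ν * Real.exp (- Real.log s / 2 - ν * s ^ 3 / 3) := by
    calc _ ≤ (x / 2) ^ ν * (1 / (√ν * Real.exp (ν * Real.log ν - ν - 1 / 2)) *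
            Real.exp (Lfun ν s - Lfun ν 1)) := by
          refine mul_le_mul_of_nonneg_left (hle.trans ?_) hx2.le
          gcongr
      _ = (1 / √ν) * Real.exp (ν * Real.log (x / 2) - (ν * Real.log ν - ν - 1 / 2) + (Lfun ν s - Lfun ν 1)) := by
          rw [Real.rpow_def_of_pos (by positivity), Real.exp_add, Real.exp_sub (ν * Real.log (x / 2)),
            mul_comm (Real.log (x / 2))]
          field_simp
      _ ≤ (1 / √ν) * Real.exp (1 / 2 + (- Real.log s / 2 - ν * s ^ 3 / 3)) := by
          refine mul_le_mul_of_nonneg_left (Real.exp_le_exp.2 ?_) (by positivity)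
          rw [hxz, Real.log_div (by positivity) (by norm_num), Real.log_mul hν0.ne' hz0.ne']
          unfold Lfun
          norm_num
          nlinarith [mul_le_mul_of_nonneg_left hlog hν0.le]
      _ = _ := by rw [Real.exp_add]; ring
  have hnx : ν - x ≤ ν * s ^ 2 := by
    rw [hxz, hs2]; nlinarith [mul_pos hz0 (sub_pos.2 hz1)]
  have hexp : Real.exp (- Real.log s / 2) = 1 / √s := by
    rw [neg_div, Real.exp_neg, Real.sqrt_eq_rpow, Real.rpow_def_of_pos hs0]
    rw [one_div]; ring_nf
  have hss : 0 < √s := Real.sqrt_pos.2 hs0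
  have hfin : √ν * √s ^ 3 * Real.exp (-(ν * s ^ 3 / 3)) ≤ 3 := by
    rw [Real.exp_neg, ← div_eq_mul_inv, div_le_iff₀ (Real.exp_pos _)]
    have h1 := Real.add_one_le_exp (ν * s ^ 3 / 3)
    have h2 : (√ν * √s ^ 3) ^ 2 = ν * s ^ 3 := by
      rw [mul_pow, ← pow_mul, Real.sq_sqrt hν0.le, mul_comm 3 2, pow_mul, Real.sq_sqrt hs0.le]
    nlinarith [sq_nonneg (√ν * √s ^ 3 - 1)]
  calc _ ≤ (Real.exp (1 / 2) / √ν * Real.exp (- Real.log s / 2 - ν * s ^ 3 / 3)) * (ν * s ^ 2) := by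
        apply mul_le_mul hb hnx (by linarith) (by positivity)
    _ = Real.exp (1 / 2) * (√ν * √s ^ 3 * Real.exp (-(ν * s ^ 3 / 3))) := by
        rw [sub_eq_add_neg, Real.exp_add, hexp]
        have e1 : ν = √ν * √ν := (Real.mul_self_sqrt hν0.le).symm
        have e2 : s ^ 2 = √s ^ 4 := by
          rw [show (4 : ℕ) = 2 * 2 by norm_num, pow_mul, Real.sq_sqrt hs0.le]
        rw [e2]
        generalize Real.exp (-(ν * s ^ 3 / 3)) = E
        nth_rewrite 2 [e1]
        field_simp
    _ ≤ Real.exp (1 / 2) * 3 := by gcongr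
    _ = _ := by ring

/-- **Decay of Bessel functions just below the turning point:** there is a constant `C`
such that `|J_ν(ν - ρ ν^{1/3})| ≤ C / (ρ ν^{1/3})` for all `ν ≥ 1` and
`1 ≤ ρ ≤ (3/2) ν^{2/3}`. -/
theorem besselJ_decay_below_turning_point :
    ∃ C : ℝ, 0 < C ∧ ∀ ν ρ : ℝ, 1 ≤ ν → 1 ≤ ρ → ρ ≤ 3 / 2 * ν ^ ((2 : ℝ) / 3) →
      |besselJ ν (ν - ρ * ν ^ ((1 : ℝ) / 3))| ≤ C / (ρ * ν ^ ((1 : ℝ) / 3)) := by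
  refine ⟨9 * Real.exp (1 / 2), by positivity, ?_⟩
  intro ν ρ hν hρ hρ2
  have hν0 : 0 < ν := by linarith
  have hc : 0 < ν ^ ((1 : ℝ) / 3) := Real.rpow_pos_of_pos hν0 _
  have hρ0 : 0 < ρ := by linarith
  have hub : ρ * ν ^ ((1 : ℝ) / 3) ≤ 3 / 2 * ν := by
    calc _ ≤ 3 / 2 * ν ^ ((2 : ℝ) / 3) * ν ^ ((1 : ℝ) / 3) := by gcongr
      _ = 3 / 2 * ν := by
        rw [mul_assoc, ← Real.rpow_add hν0]; norm_num
  have hd : 0 < ρ * ν ^ ((1 : ℝ) / 3) := by positivity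
  generalize ρ * ν ^ ((1 : ℝ) / 3) = d at *
  rw [le_div_iff₀ hd]
  have he := Real.exp_pos (1 / 2)
  rcases le_or_gt 0 (ν - d) with h | h
  · have := besselJ_main hν h (by linarith)
    rw [sub_sub_cancel] at this
    linarith
  · rw [besselJ_neg_arg h, abs_mul]
    have := besselJ_main hν (x := -(ν - d)) (by linarith) (by linarith)
    have hcos := Real.abs_cos_le_one (ν * π)
    have hJ := abs_nonneg (besselJ ν (-(ν - d)))
    generalize |besselJ ν (-(ν - d))| = j at *
    have h1 : |Real.cos (ν * π)| * j ≤ j := by nlinarith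
    calc _ ≤ j * d := by gcongr
      _ ≤ j * (3 * (ν - -(ν - d))) := by
        gcongr
        linarith
      _ ≤ _ := by linarith
end
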